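/- No explainer satisfies all of Feasibility, Success, Coherence and Irreducibility. -/

import Mathlib

/-- A classification theory: a finite set of features, a finite domain (with at
least two values) for each feature, and a finite set of at least two classes. -/
structure CTheory where
  F : Finset ℕ
  dom : ℕ → Finset ℕ
  dom_nontrivial : ∀ f ∈ F, 1 < (dom f).card
  C : Finset ℕ
  C_nontrivial : 2 ≤ C.card

/-- A literal of a theory is a pair (feature, value) with the value in the
feature's domain. -/
def IsLiteral (T : CTheory) (l : ℕ × ℕ) : Prop :=
  l.1 ∈ T.F ∧ l.2 ∈ T.dom l.1

/-- A set of literals is consistent iff no feature gets two distinct values. -/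
def ConsistentLits (S : Set (ℕ × ℕ)) : Prop :=
  ∀ l ∈ S, ∀ l' ∈ S, l.1 = l'.1 → l.2 = l'.2

/-- A partial assignment: a consistent set of literals (each feature occurs at
most once). -/
def IsPartialAssignment (T : CTheory) (E : Set (ℕ × ℕ)) : Prop :=
  (∀ l ∈ E, IsLiteral T l) ∧ ConsistentLits E

/-- An instance: a partial assignment in which every feature occurs (exactly) once. -/
def IsInstance (T : CTheory) (x : Set (ℕ × ℕ)) : Prop :=
  IsPartialAssignment T x ∧ ∀ f ∈ T.F, ∃ v, (f, v) ∈ x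

/-- The feature space of a theory: the set of all its instances. -/
def FeatureSpace (T : CTheory) : Set (Set (ℕ × ℕ)) := {x | IsInstance T x}

/-- A classifier maps every instance to a class. -/
def IsClassifier (T : CTheory) (κ : Set (ℕ × ℕ) → ℕ) : Prop :=
  ∀ x ∈ FeatureSpace T, κ x ∈ T.C

/-- A question (T, κ, D, x): κ is a classifier on T, D ⊆ F(T) and x ∈ D. -/
def IsQuestion (T : CTheory) (κ : Set (ℕ × ℕ) → ℕ)
    (D : Set (Set (ℕ × ℕ))) (x : Set (ℕ × ℕ)) : Prop :=
  IsClassifier T κ ∧ D ⊆ FeatureSpace T ∧ x ∈ D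

/-- An explainer maps every question (T, κ, D, x) to a set of sets of literals. -/
abbrev Explainer :=
  CTheory → (Set (ℕ × ℕ) → ℕ) → Set (Set (ℕ × ℕ)) → Set (ℕ × ℕ) → Set (Set (ℕ × ℕ))

/-- An explainer returns, on every question over T, a subset of E(T)
(the partial assignments of T). -/
def IsExplainer (L : Explainer) : Prop :=
  ∀ T κ D x, IsQuestion T κ D x → ∀ E ∈ L T κ D x, IsPartialAssignment T E

/-- Feasibility: every explanation is part of the instance being explained. -/
def Feasibility (L : Explainer) : Prop :=
  ∀ T κ D x, IsQuestion T κ D x → ∀ E ∈ L T κ D x, E ⊆ x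

/-- Validity: no explanation is contradicted within the dataset. -/
def Validity (L : Explainer) : Prop :=
  ∀ T κ D x, IsQuestion T κ D x → ∀ E ∈ L T κ D x,
    ¬ ∃ y ∈ D, E ⊆ y ∧ κ y ≠ κ x

/-- Success: every question receives at least one explanation. -/
def Success (L : Explainer) : Prop :=
  ∀ T κ D x, IsQuestion T κ D x → (L T κ D x).Nonempty

/-- Coherence: explanations of instances with distinct classes are jointly
inconsistent. -/
def Coherence (L : Explainer) : Prop :=
  ∀ T κ D x x', IsQuestion T κ D x → IsQuestion T κ D x' → κ x ≠ κ x' →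
    ∀ E ∈ L T κ D x, ∀ E' ∈ L T κ D x', ¬ ConsistentLits (E ∪ E')

/-- Irreducibility: no literal of an explanation can be removed
(witnessed in the dataset). -/
def Irreducibility (L : Explainer) : Prop :=
  ∀ T κ D x, IsQuestion T κ D x → ∀ E ∈ L T κ D x, ∀ l ∈ E,
    ∃ x' ∈ D, κ x' ≠ κ x ∧ E \ {l} ⊆ x'

/-- Strong Irreducibility: no literal of an explanation can be removed
(witnessed in the feature space). -/
def StrongIrreducibility (L : Explainer) : Prop :=
  ∀ T κ D x, IsQuestion T κ D x → ∀ E ∈ L T κ D x, ∀ l ∈ E,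
    ∃ x' ∈ FeatureSpace T, κ x' ≠ κ x ∧ E \ {l} ⊆ x'

/-- Completeness: every omitted candidate is invalidated within the dataset. -/
def Completeness (L : Explainer) : Prop :=
  ∀ T κ D x, IsQuestion T κ D x → ∀ E ⊆ x, E ∉ L T κ D x →
    ∃ y ∈ D, E ⊆ y ∧ κ y ≠ κ x

/-- Strong Completeness: every omitted candidate is invalidated within the
feature space. -/
def StrongCompleteness (L : Explainer) : Prop :=
  ∀ T κ D x, IsQuestion T κ D x → ∀ E ⊆ x, E ∉ L T κ D x →
    ∃ y ∈ FeatureSpace T, E ⊆ y ∧ κ y ≠ κ x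

/-- Monotonicity: enlarging the dataset preserves explanations. -/
def Monotonicity (L : Explainer) : Prop :=
  ∀ T κ D D' x, IsQuestion T κ D x → IsQuestion T κ D' x → D ⊆ D' →
    L T κ D x ⊆ L T κ D' x

/-- Counter-Monotonicity: enlarging the dataset can only discard explanations. -/
def CounterMonotonicity (L : Explainer) : Prop :=
  ∀ T κ D D' x, IsQuestion T κ D x → IsQuestion T κ D' x → D ⊆ D' →
    L T κ D' x ⊆ L T κ D x

/-- The explainer L_dw returning all weak abductive explanations (dwAXp's):
E ⊆ x and every y ∈ D containing E has the same class as x. -/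
def Ldw : Explainer := fun _T κ D x =>
  {E | E ⊆ x ∧ ∀ y ∈ D, E ⊆ y → κ y = κ x}

/-- The explainer L_w returning the weak abductive explanations computed on the
whole feature space. -/
def Lw : Explainer := fun T κ _D x => Ldw T κ (FeatureSpace T) x

/-- The explainer L_dc returning the subset-minimal weak abductive explanations
(concise abductive explanations). -/
def Ldc : Explainer := fun T κ D x =>
  {E | E ∈ Ldw T κ D x ∧ ∀ E' ∈ Ldw T κ D x, E' ⊆ E → E' = E}

/-- A set X of partial assignments is coherent under (D, κ): no two of its
members are consistent together while being contained in instances of D with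
distinct classes. -/
def CoherentSet (κ : Set (ℕ × ℕ) → ℕ) (D : Set (Set (ℕ × ℕ)))
    (X : Set (Set (ℕ × ℕ))) : Prop :=
  ¬ ∃ E ∈ X, ∃ E' ∈ X, ConsistentLits (E ∪ E') ∧
      ∃ y ∈ D, ∃ z ∈ D, E ⊆ y ∧ E' ⊆ z ∧ κ y ≠ κ z

/-- An envelope under (D, κ): a coherent set of dwAXp's covering every instance
of D. -/
def IsEnvelope (T : CTheory) (κ : Set (ℕ × ℕ) → ℕ) (D : Set (Set (ℕ × ℕ)))
    (X : Set (Set (ℕ × ℕ))) : Prop :=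
  (∀ E ∈ X, IsPartialAssignment T E) ∧
  CoherentSet κ D X ∧
  (∀ E ∈ X, ∃ x ∈ D, E ∈ Ldw T κ D x) ∧
  (∀ x ∈ D, ∃ E ∈ X, E ⊆ x)

/-- W: the union of all dwAXp's of all instances of the dataset. -/
def dwUnion (T : CTheory) (κ : Set (ℕ × ℕ) → ℕ) (D : Set (Set (ℕ × ℕ))) :
    Set (Set (ℕ × ℕ)) :=
  {E | ∃ x ∈ D, E ∈ Ldw T κ D x}

/-- The two defining conditions of an irrefutable envelope (before maximality):
a set of dwAXp's none of which conflicts with any dwAXp. -/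
def IrrCandidate (T : CTheory) (κ : Set (ℕ × ℕ) → ℕ) (D : Set (Set (ℕ × ℕ)))
    (X : Set (Set (ℕ × ℕ))) : Prop :=
  X ⊆ dwUnion T κ D ∧
  ∀ E ∈ X, ¬ ∃ E' ∈ dwUnion T κ D, ¬ CoherentSet κ D {E, E'}

/-- An irrefutable envelope under (D, κ): a subset-maximal set of mutually
irrefutable dwAXp's. -/
def IsIrrefutableEnvelope (T : CTheory) (κ : Set (ℕ × ℕ) → ℕ)
    (D : Set (Set (ℕ × ℕ))) (X : Set (Set (ℕ × ℕ))) : Prop :=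
  IrrCandidate T κ D X ∧ ∀ X', IrrCandidate T κ D X' → ¬ X ⊂ X'

/-- A coherent explainer: on every question, it returns the members of a fixed
envelope (the union of its outputs over the dataset) included in the instance. -/
def IsCoherentExplainer (L : Explainer) : Prop :=
  ∀ T κ D x, IsQuestion T κ D x →
    L T κ D x = {E | (∃ z ∈ D, E ∈ L T κ D z) ∧ E ⊆ x} ∧
    IsEnvelope T κ D {E | ∃ z ∈ D, E ∈ L T κ D z}


namespace IncompatAux

def T0 : CTheory where
  F := {0, 1, 2}
  dom := fun _ => {0, 1}
  dom_nontrivial := by intro f _; decide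
  C := {0, 1, 2}
  C_nontrivial := by decide

open Classical in
noncomputable def k0 (s : Set (ℕ × ℕ)) : ℕ :=
  if (0, 1) ∈ s then 0 else if (1, 1) ∈ s then 1 else 2

def X (a b c : ℕ) : Set (ℕ × ℕ) := {(0, a), (1, b), (2, c)}

lemma mem_X (a b c : ℕ) (l : ℕ × ℕ) :
    l ∈ X a b c ↔ l = (0, a) ∨ l = (1, b) ∨ l = (2, c) := by
  simp [X]

lemma inst (a b c : ℕ) (ha : a < 2) (hb : b < 2) (hc : c < 2) : X a b c ∈ FeatureSpace T0 := by
  refine ⟨⟨?_, ?_⟩, ?_⟩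
  · intro l hl
    rw [mem_X] at hl
    rcases hl with rfl | rfl | rfl <;> simp [IsLiteral, T0] <;> omega
  · intro l hl l' hl'
    rw [mem_X] at hl hl'
    rcases hl with rfl | rfl | rfl <;> rcases hl' with rfl | rfl | rfl <;> simp
  · intro f hf
    simp [T0] at hf
    rcases hf with rfl | rfl | rfl
    · exact ⟨a, by simp [X]⟩
    · exact ⟨b, by simp [X]⟩
    · exact ⟨c, by simp [X]⟩

def D0 : Set (Set (ℕ × ℕ)) := {X 1 0 0, X 0 1 0, X 0 0 1}

lemma quest (x : Set (ℕ × ℕ)) (hx : x ∈ D0) : IsQuestion T0 k0 D0 x := by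
  refine ⟨?_, ?_, hx⟩
  · intro s _
    unfold k0
    split_ifs <;> simp [T0]
  · intro s hs
    rcases hs with rfl | rfl | rfl <;> apply inst <;> norm_num

lemma k1 : k0 (X 1 0 0) = 0 := by simp [k0, X]
lemma k2 : k0 (X 0 1 0) = 1 := by simp [k0, X]
lemma k3 : k0 (X 0 0 1) = 2 := by simp [k0, X]

lemma conf {a b c a' b' c' : ℕ} {E E' : Set (ℕ × ℕ)} (h : E ⊆ X a b c) (h' : E' ⊆ X a' b' c')
    (hc : ¬ ConsistentLits (E ∪ E')) :
    (a ≠ a' ∧ (0, a) ∈ E ∧ (0, a') ∈ E') ∨ (b ≠ b' ∧ (1, b) ∈ E ∧ (1, b') ∈ E') ∨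
      (c ≠ c' ∧ (2, c) ∈ E ∧ (2, c') ∈ E') := by
  by_contra hn
  apply hc
  have key : ∀ l ∈ E, ∀ l' ∈ E', l.1 = l'.1 → l.2 = l'.2 := by
    intro l hl l' hl' e
    have h1 := (mem_X _ _ _ _).1 (h hl)
    have h2 := (mem_X _ _ _ _).1 (h' hl')
    rcases h1 with rfl | rfl | rfl <;> rcases h2 with rfl | rfl | rfl <;> simp at e ⊢ <;> tauto
  have self : ∀ {p q r : ℕ} {G : Set (ℕ × ℕ)}, G ⊆ X p q r →
      ∀ l ∈ G, ∀ l' ∈ G, l.1 = l'.1 → l.2 = l'.2 := by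
    intro p q r G hG l hl l' hl' e
    have h1 := (mem_X _ _ _ _).1 (hG hl)
    have h2 := (mem_X _ _ _ _).1 (hG hl')
    rcases h1 with rfl | rfl | rfl <;> rcases h2 with rfl | rfl | rfl <;> simp at e ⊢
  rintro l (hl | hl) l' (hl' | hl') e
  · exact self h l hl l' hl' e
  · exact key l hl l' hl' e
  · exact (key l' hl' l hl e.symm).symm
  · exact self h' l hl l' hl' e

lemma sub_iff {E : Set (ℕ × ℕ)} {l : ℕ × ℕ} {a b c : ℕ} (h : E \ {l} ⊆ X a b c) (m : ℕ × ℕ)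
    (hm : m ∈ E) (hne : m ≠ l) : m = (0, a) ∨ m = (1, b) ∨ m = (2, c) :=
  (mem_X _ _ _ _).1 (h ⟨hm, hne⟩)

end IncompatAux

open IncompatAux in
theorem incompat_feasibility_success_coherence_irreducibility :
    ¬ ∃ L : Explainer, IsExplainer L ∧
      Feasibility L ∧ Success L ∧ Coherence L ∧ Irreducibility L := by
  rintro ⟨L, -, hF, hS, hC, hI⟩
  have q1 := quest (X 1 0 0) (by simp [D0])
  have q2 := quest (X 0 1 0) (by simp [D0])
  have q3 := quest (X 0 0 1) (by simp [D0])
  obtain ⟨E1, e1⟩ := hS _ _ _ _ q1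
  obtain ⟨E2, e2⟩ := hS _ _ _ _ q2
  obtain ⟨E3, e3⟩ := hS _ _ _ _ q3
  have f1 := hF _ _ _ _ q1 _ e1
  have f2 := hF _ _ _ _ q2 _ e2
  have f3 := hF _ _ _ _ q3 _ e3
  have c12 := conf f1 f2 (hC _ _ _ _ _ q1 q2 (by simp [k1, k2]) _ e1 _ e2)
  have c13 := conf f1 f3 (hC _ _ _ _ _ q1 q3 (by simp [k1, k3]) _ e1 _ e3)
  have c23 := conf f2 f3 (hC _ _ _ _ _ q2 q3 (by simp [k2, k3]) _ e2 _ e3)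
  have a1 : (1, 0) ∈ E1 → (0, 1) ∉ E1 := by
    intro h h'
    obtain ⟨x', hx, hk, hs⟩ := hI _ _ _ _ q1 _ e1 _ h
    rcases hx with rfl | rfl | rfl
    · exact hk rfl
    all_goals simpa using sub_iff hs _ h' (by simp)
  have a2 : (2, 0) ∈ E1 → (0, 1) ∉ E1 := by
    intro h h'
    obtain ⟨x', hx, hk, hs⟩ := hI _ _ _ _ q1 _ e1 _ h
    rcases hx with rfl | rfl | rfl
    · exact hk rfl
    all_goals simpa using sub_iff hs _ h' (by simp)
  have b1 : (0, 0) ∈ E2 → (1, 1) ∉ E2 := by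
    intro h h'
    obtain ⟨x', hx, hk, hs⟩ := hI _ _ _ _ q2 _ e2 _ h
    rcases hx with rfl | rfl | rfl
    rotate_left
    · exact hk rfl
    all_goals simpa using sub_iff hs _ h' (by simp)
  have b2 : (2, 0) ∈ E2 → (1, 1) ∉ E2 := by
    intro h h'
    obtain ⟨x', hx, hk, hs⟩ := hI _ _ _ _ q2 _ e2 _ h
    rcases hx with rfl | rfl | rfl
    rotate_left
    · exact hk rfl
    all_goals simpa using sub_iff hs _ h' (by simp)
  have d1 : (0, 0) ∈ E3 → (2, 1) ∉ E3 := by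
    intro h h'
    obtain ⟨x', hx, hk, hs⟩ := hI _ _ _ _ q3 _ e3 _ h
    rcases hx with rfl | rfl | rfl
    rotate_right
    · exact hk rfl
    all_goals simpa using sub_iff hs _ h' (by simp)
  have d2 : (1, 0) ∈ E3 → (2, 1) ∉ E3 := by
    intro h h'
    obtain ⟨x', hx, hk, hs⟩ := hI _ _ _ _ q3 _ e3 _ h
    rcases hx with rfl | rfl | rfl
    rotate_right
    · exact hk rfl
    all_goals simpa using sub_iff hs _ h' (by simp)
  simp at c12 c13 c23
  tauto
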